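/- For a memoryless point-to-point communication system with noncausal encoder, the following inner bound on the coordination region holds: if there exists a finite set 𝒰 and a joint pmf P_{SXYŜU} on 𝒮×𝒳×𝒴×Ŝ×𝒰 that factors as P_S(s)·P_{U|S}(u|s)·P_{X|US}(x|u,s)·P_{Y|X}(y|x)·P_{Ŝ|UY}(ŝ|u,y) and satisfies I(U;S) ≤ I(U;Y), then the marginal P_{SXYŜ} is achievable with a noncausal encoder. -/

import Mathlib

open scoped BigOperators

noncomputable section

/-- `p` is a probability mass function on the finite type `α`. -/
def IsPMF {α : Type*} [Fintype α] (p : α → ℝ) : Prop :=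
  (∀ a, 0 ≤ p a) ∧ (∑ a, p a) = 1

/-- Probability of the event `E` under the pmf `P`. -/
def prob {Ω : Type*} [Fintype Ω] (P : Ω → ℝ) (E : Set Ω) : ℝ :=
  ∑ ω, E.indicator P ω

/-- Probability that the random variable `f` takes the value `a`, under `P`. -/
def margProb {Ω A : Type*} [Fintype Ω] (P : Ω → ℝ) (f : Ω → A) (a : A) : ℝ :=
  prob P {ω | f ω = a}

/-- Mutual information `I(f;g)` (base-2 logarithms) of random variables `f`, `g`
defined on a finite probability space with pmf `P`. -/
def mutInfo {Ω A B : Type*} [Fintype Ω] [Fintype A] [Fintype B]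
    (P : Ω → ℝ) (f : Ω → A) (g : Ω → B) : ℝ :=
  ∑ a : A, ∑ b : B,
    margProb P (fun ω => (f ω, g ω)) (a, b) *
      Real.logb 2 (margProb P (fun ω => (f ω, g ω)) (a, b) /
        (margProb P f a * margProb P g b))

/-- Conditional mutual information `I(f;g|h)` (base-2 logarithms). -/
def condMutInfo {Ω A B C : Type*} [Fintype Ω] [Fintype A] [Fintype B] [Fintype C]
    (P : Ω → ℝ) (f : Ω → A) (g : Ω → B) (h : Ω → C) : ℝ :=
  ∑ a : A, ∑ b : B, ∑ c : C,
    margProb P (fun ω => (f ω, g ω, h ω)) (a, b, c) *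
      Real.logb 2
        ((margProb P (fun ω => (f ω, g ω, h ω)) (a, b, c) * margProb P h c) /
          (margProb P (fun ω => (f ω, h ω)) (a, c) *
            margProb P (fun ω => (g ω, h ω)) (b, c)))

/-- Total variation distance between two pmfs: half the ℓ¹ distance. -/
def tvDist {α : Type*} [Fintype α] (P Q : α → ℝ) : ℝ :=
  (∑ a, |P a - Q a|) / 2

/-- Empirical distribution of the sequence `w`. -/
def empDist {n : ℕ} {α : Type*} (w : Fin n → α) (a : α) : ℝ :=
  (∑ i : Fin n, ({i | w i = a} : Set (Fin n)).indicator (fun _ => (1 : ℝ)) i) / n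

/-- Causality classes for the encoder. -/
inductive EncoderClass | noncausal | causal | strictlyCausal

/-- The encoder `f` respects the causality class `c`:
a noncausal encoder has `Xᵢ = fᵢ(Sⁿ)`, a causal encoder has `Xᵢ = fᵢ(Sⁱ)`
(it only depends on `S₁,…,Sᵢ`), and a strictly causal encoder has
`Xᵢ = fᵢ(Sⁱ⁻¹)` (it only depends on `S₁,…,Sᵢ₋₁`). -/
def EncOK {n : ℕ} {S X : Type*} : EncoderClass → (Fin n → (Fin n → S) → X) → Prop
  | .noncausal, _ => True
  | .causal, f => ∀ (i : Fin n) (s s' : Fin n → S),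
      (∀ j, j ≤ i → s j = s' j) → f i s = f i s'
  | .strictlyCausal, f => ∀ (i : Fin n) (s s' : Fin n → S),
      (∀ j, j < i → s j = s' j) → f i s = f i s'

/-- The joint pmf of `(Sⁿ, Yⁿ)` induced by the i.i.d. source `PS`, the memoryless
channel `PYX` and the (deterministic) encoder `f`. -/
def inducedP {S X Y : Type*} {n : ℕ}
    (PS : S → ℝ) (PYX : X → Y → ℝ) (f : Fin n → (Fin n → S) → X) :
    (Fin n → S) × (Fin n → Y) → ℝ :=
  fun sy => (∏ i, PS (sy.1 i)) * ∏ i, PYX (f i sy.1) (sy.2 i)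

/-- `P` (a pmf on `S × X × Y × Z`) is achievable for the source `PS` and channel `PYX`
with an encoder of causality class `c`: for every `ε > 0` there are a block length
`n` and a block-`n` code such that with probability at least `1 - ε` the empirical
distribution of `(Sⁿ, Xⁿ, Yⁿ, Ŝⁿ)` is within total variation `ε` of `P`. -/
def Achievable {S X Y Z : Type*} [Fintype S] [Fintype X] [Fintype Y] [Fintype Z]
    (PS : S → ℝ) (PYX : X → Y → ℝ) (c : EncoderClass)
    (P : S × X × Y × Z → ℝ) : Prop :=
  ∀ ε : ℝ, 0 < ε →
    ∃ n : ℕ, 0 < n ∧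
      ∃ (f : Fin n → (Fin n → S) → X) (g : Fin n → (Fin n → Y) → Z),
        EncOK c f ∧
        prob (inducedP PS PYX f)
          {sy | ε <
            tvDist (empDist (fun i => (sy.1 i, f i sy.1, sy.2 i, g i sy.2))) P} < ε


section ProductSums

variable {A : Type*} [Fintype A]

lemma sum_arrow_prod {ι A B : Type*} [Fintype ι] [DecidableEq ι] [Fintype A] [Fintype B]
    (F : (ι → A × B) → ℝ) :
    ∑ ω, F ω = ∑ a : ι → A, ∑ b : ι → B, F (fun i => (a i, b i)) := by
  rw [← Fintype.sum_prod_type' (f := fun (a : ι → A) (b : ι → B) => F (fun i => (a i, b i)))]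
  exact Fintype.sum_equiv (Equiv.arrowProdEquivProdArrow ι (fun _ => A) (fun _ => B)) _ _
    (fun _ => rfl)

lemma sum_pi_prod {ι : Type*} [Fintype ι] [DecidableEq ι] (h : ι → A → ℝ) :
    ∑ c : ι → A, ∏ i, h i (c i) = ∏ i, ∑ a, h i a := by
  simpa using (Finset.prod_univ_sum (fun _ : ι => (Finset.univ : Finset A)) h).symm

lemma IsPMF.prod_pi {ι : Type*} [Fintype ι] [DecidableEq ι] {p : ι → A → ℝ}
    (hp : ∀ i, IsPMF (p i)) : IsPMF (fun c : ι → A => ∏ i, p i (c i)) :=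
  ⟨fun c => Finset.prod_nonneg fun i _ => (hp i).1 (c i), by
    rw [sum_pi_prod]; exact Finset.prod_eq_one fun i _ => (hp i).2⟩

lemma sum_iid_eval {ι : Type*} [Fintype ι] [DecidableEq ι] {p : A → ℝ} (hp : IsPMF p)
    (φ : A → ℝ) (j : ι) :
    ∑ c : ι → A, (∏ i, p (c i)) * φ (c j) = ∑ a, p a * φ a := by
  have h := sum_pi_prod (fun (i : ι) a => p a * if i = j then φ a else 1)
  simp only [Finset.prod_mul_distrib, Finset.prod_ite_eq', Finset.mem_univ, if_true] at h
  rw [h, Finset.prod_eq_single j (fun i _ hij => by simp [hij, hp.2]) (by simp)]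
  simp

lemma sum_iid_eval_mul_eval {ι : Type*} [Fintype ι] [DecidableEq ι] {p : A → ℝ} (hp : IsPMF p)
    (φ ψ : A → ℝ) {j k : ι} (hjk : j ≠ k) :
    ∑ c : ι → A, (∏ i, p (c i)) * (φ (c j) * ψ (c k)) =
      (∑ a, p a * φ a) * ∑ a, p a * ψ a := by
  have h := sum_pi_prod
    (fun (i : ι) a => p a * ((if i = j then φ a else 1) * if i = k then ψ a else 1))
  simp only [Finset.prod_mul_distrib, Finset.prod_ite_eq', Finset.mem_univ, if_true] at h
  rw [h, Finset.prod_eq_mul j k hjk (fun i _ hi => by simp [hi.1, hi.2, hp.2]) (by simp) (by simp)]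
  simp [hjk, hjk.symm]

lemma sum_iid_sq_sum {p : A → ℝ} (hp : IsPMF p) (n : ℕ) (ψ : A → ℝ)
    (hψ : ∑ a, p a * ψ a = 0) :
    ∑ c : Fin n → A, (∏ i, p (c i)) * (∑ i, ψ (c i)) ^ 2 = n * ∑ a, p a * ψ a ^ 2 := by
  have key : ∀ j k : Fin n, ∑ c : Fin n → A, (∏ i, p (c i)) * (ψ (c j) * ψ (c k)) =
      if j = k then ∑ a, p a * ψ a ^ 2 else 0 := by
    intro j k
    split_ifs with h
    · subst h
      simpa [sq] using sum_iid_eval hp (fun a => ψ a * ψ a) j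
    · rw [sum_iid_eval_mul_eval hp _ _ h, hψ, zero_mul]
  calc ∑ c : Fin n → A, (∏ i, p (c i)) * (∑ i, ψ (c i)) ^ 2
      = ∑ c : Fin n → A, ∑ j, ∑ k, (∏ i, p (c i)) * (ψ (c j) * ψ (c k)) := by
        refine Finset.sum_congr rfl fun c _ => ?_
        simp_rw [sq, Finset.sum_mul_sum, Finset.mul_sum]
    _ = ∑ j, ∑ k, ∑ c : Fin n → A, (∏ i, p (c i)) * (ψ (c j) * ψ (c k)) := by
        rw [Finset.sum_comm]
        exact Finset.sum_congr rfl fun j _ => Finset.sum_comm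
    _ = n * ∑ a, p a * ψ a ^ 2 := by simp [key]

end ProductSums

section Prob

variable {Ω : Type*} [Fintype Ω] {P : Ω → ℝ}

lemma prob_mono (hP : ∀ ω, 0 ≤ P ω) {E F : Set Ω} (h : E ⊆ F) : prob P E ≤ prob P F :=
  Finset.sum_le_sum fun ω _ => Set.indicator_le_indicator_of_subset h hP ω

lemma prob_compl (hP : IsPMF P) (E : Set Ω) : prob P Eᶜ = 1 - prob P E := by
  rw [← hP.2, eq_sub_iff_add_eq, prob, prob, ← Finset.sum_add_distrib]
  exact Finset.sum_congr rfl fun ω _ => by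
    by_cases h : ω ∈ E <;> simp [h]

lemma add_prob_sub_one_le_prob_inter (hP : IsPMF P) (E F : Set Ω) :
    prob P E + prob P F - 1 ≤ prob P (E ∩ F) := by
  rw [← hP.2, sub_le_iff_le_add, prob, prob, prob, ← Finset.sum_add_distrib,
    ← Finset.sum_add_distrib]
  refine Finset.sum_le_sum fun ω _ => ?_
  have := hP.1 ω
  by_cases hE : ω ∈ E <;> by_cases hF : ω ∈ F <;> simp [hE, hF, this]

/-- Weak law of large numbers for finitely many functions of an i.i.d. sequence. -/
lemma exists_prob_iid_gt {A κ : Type*} [Fintype A] [Fintype κ] {p : A → ℝ} (hp : IsPMF p)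
    (φ : κ → A → ℝ) {η δ : ℝ} (hη : 0 < η) (hδ : 0 < δ) :
    ∃ n₀ : ℕ, ∀ n ≥ n₀, ∀ T : Set (Fin n → A),
      (∀ ω, (∀ i, 0 < p (ω i)) →
        (∀ k, |∑ i, φ k (ω i) - n * ∑ a, p a * φ k a| ≤ n * η) → ω ∈ T) →
      1 - δ < prob (fun ω => ∏ i, p (ω i)) T := by
  set ψ : κ → A → ℝ := fun k a => φ k a - ∑ b, p b * φ k b with hψ
  have hψ0 : ∀ k, ∑ a, p a * ψ k a = 0 := fun k => by
    simp [hψ, mul_sub, Finset.sum_sub_distrib, ← Finset.sum_mul, hp.2]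
  set V : ℝ := ∑ k, ∑ a, p a * ψ k a ^ 2 with hV
  obtain ⟨n₀, hn₀⟩ := exists_nat_gt (V / (δ * η ^ 2))
  refine ⟨n₀ + 1, fun n hn T hT => ?_⟩
  have hnpos : (0 : ℝ) < n := by exact_mod_cast (show 0 < n by omega)
  have hw := IsPMF.prod_pi (fun _ : Fin n => hp)
  have hVn : V / (n * η ^ 2) < δ := by
    have : V / (δ * η ^ 2) < n := hn₀.trans (by exact_mod_cast (show n₀ < n by omega))
    rw [div_lt_iff₀ (by positivity)] at this ⊢
    linarith
  have hpt : ∀ ω : Fin n → A, (∏ i, p (ω i)) -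
      ∑ k, (∏ i, p (ω i)) * (∑ i, ψ k (ω i)) ^ 2 / (n * η) ^ 2 ≤
      T.indicator (fun ω => ∏ i, p (ω i)) ω := by
    intro ω
    have hw0 := hw.1 ω
    have hnn : ∀ k ∈ Finset.univ, 0 ≤ (∏ i, p (ω i)) * (∑ i, ψ k (ω i)) ^ 2 / (n * η) ^ 2 :=
      fun k _ => by positivity
    by_cases hω : ω ∈ T
    · rw [Set.indicator_of_mem hω]
      linarith [Finset.sum_nonneg hnn]
    rw [Set.indicator_of_notMem hω]
    rcases hw0.eq_or_lt with h0 | h0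
    · simp only [← h0]; simp
    have hpos : ∀ i, 0 < p (ω i) := fun i =>
      (hp.1 _).lt_of_ne' fun h => h0.ne' (Finset.prod_eq_zero (Finset.mem_univ i) h)
    obtain ⟨k, hk⟩ : ∃ k, ¬ |∑ i, φ k (ω i) - n * ∑ a, p a * φ k a| ≤ n * η := by
      by_contra! h
      exact hω (hT ω hpos h)
    have hk' : n * η < |∑ i, ψ k (ω i)| := by
      simpa [hψ, Finset.sum_sub_distrib] using hk
    have h1 : (∏ i, p (ω i)) ≤ (∏ i, p (ω i)) * (∑ i, ψ k (ω i)) ^ 2 / (n * η) ^ 2 := by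
      rw [le_div_iff₀ (by positivity)]
      refine mul_le_mul_of_nonneg_left ?_ hw0
      rw [← sq_abs (∑ i, ψ k (ω i))]
      exact pow_le_pow_left₀ (by positivity) hk'.le 2
    linarith [Finset.single_le_sum hnn (Finset.mem_univ k)]
  have hsum : 1 - V / (n * η ^ 2) ≤ prob (fun ω : Fin n → A => ∏ i, p (ω i)) T := by
    refine le_trans (le_of_eq ?_) (Finset.sum_le_sum fun ω _ => hpt ω)
    rw [Finset.sum_sub_distrib, hw.2, Finset.sum_comm]
    congr 1
    rw [hV, Finset.sum_div]
    refine Finset.sum_congr rfl fun k _ => ?_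
    rw [← Finset.sum_div, sum_iid_sq_sum hp n _ (hψ0 k)]
    field_simp
  linarith

end Prob

section OneShot

lemma exists_sum_mul_le {A : Type*} [Fintype A] [Nonempty A] {w : A → ℝ}
    (hw : ∀ a, 0 ≤ w a) (hw1 : ∑ a, w a ≤ 1) {h : A → ℝ} (hh : ∀ a, 0 ≤ h a) :
    ∃ a, ∑ b, w b * h b ≤ h a := by
  obtain ⟨a, ha⟩ := Finite.exists_max h
  refine ⟨a, ?_⟩
  calc ∑ b, w b * h b ≤ ∑ b, w b * h a :=
        Finset.sum_le_sum fun b _ => mul_le_mul_of_nonneg_left (ha b) (hw b)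
    _ = (∑ b, w b) * h a := by rw [Finset.sum_mul]
    _ ≤ h a := mul_le_of_le_one_left (hh a) hw1

/-- A randomized encoder and decoder can be replaced by deterministic ones. -/
lemma exists_deterministic_code {S X Y Z : Type*} [Fintype S] [Fintype X] [Fintype Y] [Fintype Z]
    [Nonempty X] [Nonempty Z]
    {pS : S → ℝ} {W : S → X → ℝ} {V : X → Y → ℝ} {D : Y → Z → ℝ} {G : S → X → Y → Z → ℝ}
    (hpS : ∀ s, 0 ≤ pS s) (hW : ∀ s x, 0 ≤ W s x) (hW1 : ∀ s, ∑ x, W s x ≤ 1)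
    (hV : ∀ x y, 0 ≤ V x y) (hD : ∀ y z, 0 ≤ D y z) (hD1 : ∀ y, ∑ z, D y z ≤ 1)
    (hG : ∀ s x y z, 0 ≤ G s x y z) :
    ∃ (f : S → X) (g : Y → Z),
      ∑ s, ∑ x, ∑ y, ∑ z, pS s * W s x * V x y * D y z * G s x y z ≤
        ∑ s, ∑ y, pS s * V (f s) y * G s (f s) y (g y) := by
  have hg : ∀ y, ∃ z, ∑ z', D y z' * (∑ s, ∑ x, pS s * W s x * V x y * G s x y z') ≤
      ∑ s, ∑ x, pS s * W s x * V x y * G s x y z := fun y =>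
    exists_sum_mul_le (hD y) (hD1 y) fun z => Finset.sum_nonneg fun s _ =>
      Finset.sum_nonneg fun x _ => mul_nonneg
        (mul_nonneg (mul_nonneg (hpS s) (hW s x)) (hV x y)) (hG s x y z)
  choose g hg using hg
  have hf : ∀ s, ∃ x, ∑ x', W s x' * (∑ y, V x' y * G s x' y (g y)) ≤
      ∑ y, V x y * G s x y (g y) := fun s =>
    exists_sum_mul_le (hW s) (hW1 s) fun x => Finset.sum_nonneg fun y _ =>
      mul_nonneg (hV x y) (hG s x y _)
  choose f hf using hf
  refine ⟨f, g, ?_⟩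
  calc ∑ s, ∑ x, ∑ y, ∑ z, pS s * W s x * V x y * D y z * G s x y z
      = ∑ y, ∑ z, D y z * (∑ s, ∑ x, pS s * W s x * V x y * G s x y z) := by
        simp_rw [Finset.mul_sum]
        rw [Finset.sum_congr rfl fun s _ => Finset.sum_comm, Finset.sum_comm]
        refine Finset.sum_congr rfl fun y _ => ?_
        rw [Finset.sum_congr rfl fun s _ => Finset.sum_comm, Finset.sum_comm]
        refine Finset.sum_congr rfl fun z _ => Finset.sum_congr rfl fun s _ =>
          Finset.sum_congr rfl fun x _ => by ring
    _ ≤ ∑ y, ∑ s, ∑ x, pS s * W s x * V x y * G s x y (g y) :=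
        Finset.sum_le_sum fun y _ => hg y
    _ = ∑ s, pS s * ∑ x, W s x * ∑ y, V x y * G s x y (g y) := by
        simp_rw [Finset.mul_sum]
        rw [Finset.sum_comm]
        refine Finset.sum_congr rfl fun s _ => ?_
        rw [Finset.sum_comm]
        refine Finset.sum_congr rfl fun x _ => Finset.sum_congr rfl fun y _ => by ring
    _ ≤ ∑ s, pS s * ∑ y, V (f s) y * G s (f s) y (g y) :=
        Finset.sum_le_sum fun s _ => mul_le_mul_of_nonneg_left (hf s) (hpS s)
    _ = _ := by simp_rw [Finset.mul_sum, mul_assoc]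

/-- The tangent plane at `(a₀, b₀)` lies below the graph of the convex function `1 / (a b)`. -/
lemma inv_mul_tangent_le {a b a₀ b₀ : ℝ} (ha : 0 < a) (hb : 0 < b) (ha₀ : 0 < a₀)
    (hb₀ : 0 < b₀) :
    1 / (a₀ * b₀) * (3 - a / a₀ - b / b₀) ≤ 1 / (a * b) := by
  have key : ∀ x y : ℝ, 0 < x → 0 < y → (3 - x - y) * (x * y) ≤ 1 := by
    intro x y hx hy
    nlinarith [sq_nonneg (x - y), sq_nonneg (x + y - 2), mul_pos hx hy,
      mul_nonneg (add_pos hx hy).le (sq_nonneg (x - y)),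
      mul_nonneg (add_pos hx hy).le (sq_nonneg (x + y - 2)), add_pos hx hy]
  have h := key (a / a₀) (b / b₀) (by positivity) (by positivity)
  rw [le_div_iff₀ (by positivity)]
  calc _ = (3 - a / a₀ - b / b₀) * (a / a₀ * (b / b₀)) := by field_simp
    _ ≤ 1 := h

/-- Jensen's inequality for the product of two posterior weights of a random codebook. -/
lemma le_sum_codebook {U : Type*} [Fintype U] {pU : U → ℝ} (hpU : IsPMF pU) {L K c : U → ℝ}
    (hL : ∀ u, 0 ≤ L u) (hK : ∀ u, 0 ≤ K u) (hc : ∀ u, 0 ≤ c u)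
    (hL1 : ∑ u, pU u * L u ≤ 1) (hK1 : ∑ u, pU u * K u ≤ 1) (N : ℕ) :
    ∑ u, pU u * (c u * L u * ((N + 1) / (L u + N)) * (K u / (K u + N))) ≤
      ∑ C : Fin (N + 1) → U, (∏ i, pU (C i)) *
        ∑ m, c (C m) * (L (C m) / ∑ j, L (C j)) * (K (C m) / ∑ j, K (C j)) := by
  set φ : U → ℝ := fun u => c u * L u * K u * (1 / ((L u + N) * (K u + N))) with hφ
  have hN : (0 : ℝ) ≤ N := N.cast_nonneg
  have hφ0 : ∀ u, 0 ≤ φ u := fun u => by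
    have := hL u; have := hK u; have := hc u; positivity
  have hpt : ∀ (C : Fin (N + 1) → U) m,
      φ (C m) * (3 - (∑ j, L (C j)) / (L (C m) + N) - (∑ j, K (C j)) / (K (C m) + N)) ≤
        c (C m) * (L (C m) / ∑ j, L (C j)) * (K (C m) / ∑ j, K (C j)) := by
    intro C m
    have hA0 : L (C m) ≤ ∑ j, L (C j) :=
      Finset.single_le_sum (f := fun j => L (C j)) (fun j _ => hL _) (Finset.mem_univ m)
    have hB0 : K (C m) ≤ ∑ j, K (C j) :=
      Finset.single_le_sum (f := fun j => K (C j)) (fun j _ => hK _) (Finset.mem_univ m)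
    rcases (hL (C m)).eq_or_lt with h | hLp
    · simp [hφ, ← h]
    rcases (hK (C m)).eq_or_lt with h | hKp
    · simp [hφ, ← h]
    have h := inv_mul_tangent_le (hLp.trans_le hA0) (hKp.trans_le hB0)
      (add_pos_of_pos_of_nonneg hLp hN) (add_pos_of_pos_of_nonneg hKp hN)
    have h' := mul_le_mul_of_nonneg_left h
      (mul_nonneg (mul_nonneg (hc (C m)) hLp.le) hKp.le)
    refine le_trans (le_of_eq ?_) (h'.trans (le_of_eq ?_))
    · simp only [hφ]; ring
    · have := (hLp.trans_le hA0).ne'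
      have := (hKp.trans_le hB0).ne'
      field_simp
  have hE : ∀ (F : U → ℝ), (∀ u, 0 ≤ F u) → ∑ u, pU u * F u ≤ 1 → ∀ m : Fin (N + 1),
      ∑ C : Fin (N + 1) → U, (∏ i, pU (C i)) * (φ (C m) * ((∑ j, F (C j)) / (F (C m) + N))) ≤
        ∑ u, pU u * φ u := by
    intro F hF hF1 m
    set χ : U → ℝ := fun u => φ u / (F u + N) with hχ
    have hχ0 : ∀ u, 0 ≤ χ u := fun u => div_nonneg (hφ0 u) (add_nonneg (hF u) hN)
    have h1 : ∀ C : Fin (N + 1) → U,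
        (∏ i, pU (C i)) * (φ (C m) * ((∑ j, F (C j)) / (F (C m) + N))) =
        (∏ i, pU (C i)) * (χ (C m) * F (C m)) +
          ∑ j ∈ Finset.univ.erase m, (∏ i, pU (C i)) * (χ (C m) * F (C j)) := by
      intro C
      rw [Finset.add_sum_erase _ (fun j => (∏ i, pU (C i)) * (χ (C m) * F (C j)))
        (Finset.mem_univ m), ← Finset.mul_sum, ← Finset.mul_sum]
      simp only [hχ]; ring
    have h2 : ∑ C : Fin (N + 1) → U, ∑ j ∈ Finset.univ.erase m,
        (∏ i, pU (C i)) * (χ (C m) * F (C j)) ≤ N * ∑ u, pU u * χ u := by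
      rw [Finset.sum_comm]
      have : ∀ j ∈ Finset.univ.erase m, ∑ C : Fin (N + 1) → U,
          (∏ i, pU (C i)) * (χ (C m) * F (C j)) ≤ ∑ u, pU u * χ u := by
        intro j hj
        rw [sum_iid_eval_mul_eval hpU χ F (Finset.ne_of_mem_erase hj).symm]
        exact mul_le_of_le_one_right
          (Finset.sum_nonneg fun u _ => mul_nonneg (hpU.1 u) (hχ0 u)) hF1
      refine (Finset.sum_le_sum this).trans (le_of_eq ?_)
      simp [Finset.card_erase_of_mem]
    rw [Finset.sum_congr rfl fun C _ => h1 C, Finset.sum_add_distrib,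
      sum_iid_eval hpU (fun u => χ u * F u)]
    refine (add_le_add_right h2 _).trans ?_
    rw [Finset.mul_sum, ← Finset.sum_add_distrib]
    refine Finset.sum_le_sum fun u _ => ?_
    have : χ u * (F u + N) ≤ φ u := by
      rcases eq_or_ne (F u + N) 0 with h | h
      · rw [h, mul_zero]; exact hφ0 u
      · simp only [hχ]; rw [div_mul_cancel₀ _ h]
    calc pU u * (χ u * F u) + N * (pU u * χ u) = pU u * (χ u * (F u + N)) := by ring
      _ ≤ _ := mul_le_mul_of_nonneg_left this (hpU.1 u)
  have hm : ∀ m : Fin (N + 1), ∑ u, pU u * φ u ≤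
      ∑ C : Fin (N + 1) → U, (∏ i, pU (C i)) *
        (c (C m) * (L (C m) / ∑ j, L (C j)) * (K (C m) / ∑ j, K (C j))) := by
    intro m
    refine le_trans ?_ (Finset.sum_le_sum fun C _ => mul_le_mul_of_nonneg_left (hpt C m)
      (Finset.prod_nonneg fun i _ => hpU.1 _))
    have e : ∀ C : Fin (N + 1) → U, (∏ i, pU (C i)) *
        (φ (C m) * (3 - (∑ j, L (C j)) / (L (C m) + N) - (∑ j, K (C j)) / (K (C m) + N))) =
        3 * ((∏ i, pU (C i)) * φ (C m)) -
        (∏ i, pU (C i)) * (φ (C m) * ((∑ j, L (C j)) / (L (C m) + N))) -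
        (∏ i, pU (C i)) * (φ (C m) * ((∑ j, K (C j)) / (K (C m) + N))) := fun C => by ring
    rw [Finset.sum_congr rfl fun C _ => e C, Finset.sum_sub_distrib, Finset.sum_sub_distrib,
      ← Finset.mul_sum, sum_iid_eval hpU φ]
    linarith [hE L hL hL1 m, hE K hK hK1 m]
  calc _ = ∑ _m : Fin (N + 1), ∑ u, pU u * φ u := by
        rw [Finset.sum_const, Finset.card_univ, Fintype.card_fin, nsmul_eq_mul, Finset.mul_sum]
        refine Finset.sum_congr rfl fun u _ => ?_
        simp only [hφ, Nat.cast_add, Nat.cast_one]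
        rw [one_div, mul_inv, div_eq_mul_inv, div_eq_mul_inv]
        ring
    _ ≤ _ := Finset.sum_le_sum fun m _ => hm m
    _ = _ := by
        rw [Finset.sum_comm]
        exact Finset.sum_congr rfl fun C _ => by rw [Finset.mul_sum]

lemma codeword_weight_nonneg {U B ι : Type*} [Fintype ι] {F : U → B → ℝ} (hF : ∀ u b, 0 ≤ F u b)
    (C : ι → U) (m : ι) (b : B) : 0 ≤ F (C m) b / ∑ j, F (C j) b :=
  div_nonneg (hF _ b) (Finset.sum_nonneg fun _ _ => hF _ b)

lemma sum_codeword_mixture_le_one {U A B ι : Type*} [Fintype ι] [Fintype A] (C : ι → U)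
    (F : U → B → ℝ) {R : U → B → A → ℝ} (hR : ∀ u b, IsPMF (R u b)) (b : B) :
    ∑ a, ∑ m, F (C m) b / (∑ j, F (C j) b) * R (C m) b a ≤ 1 := by
  rw [Finset.sum_comm]
  simp_rw [← Finset.mul_sum, (hR _ b).2, mul_one, ← Finset.sum_div]
  exact div_self_le_one _

/-- One-shot coding bound: a random codebook of `N + 1` words with posterior-sampling encoder and
decoder yields a deterministic code satisfying the stated bound on its success probability. -/
lemma exists_oneShot_code {S X Y Z U : Type*} [Fintype S] [Fintype X] [Fintype Y] [Fintype Z]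
    [Fintype U] [Nonempty X] [Nonempty Z]
    {pU : U → ℝ} {pS : S → ℝ} {L : U → S → ℝ} {K : U → Y → ℝ} {PX : U → S → X → ℝ}
    {V : X → Y → ℝ} {PZ : U → Y → Z → ℝ} {G : S → X → Y → Z → ℝ}
    (hpU : IsPMF pU) (hpS : ∀ s, 0 ≤ pS s)
    (hL : ∀ u s, 0 ≤ L u s) (hL1 : ∀ s, ∑ u, pU u * L u s ≤ 1)
    (hK : ∀ u y, 0 ≤ K u y) (hK1 : ∀ y, ∑ u, pU u * K u y ≤ 1)
    (hPX : ∀ u s, IsPMF (PX u s)) (hV : ∀ x y, 0 ≤ V x y) (hPZ : ∀ u y, IsPMF (PZ u y))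
    (hG : ∀ s x y z, 0 ≤ G s x y z) (N : ℕ) :
    ∃ (f : S → X) (g : Y → Z),
      ∑ s, ∑ x, ∑ y, ∑ z, ∑ u, pU u * pS s * L u s * PX u s x * V x y * PZ u y z *
          (G s x y z * (((N + 1) / (L u s + N)) * (K u y / (K u y + N)))) ≤
        ∑ s, ∑ y, pS s * V (f s) y * G s (f s) y (g y) := by
  set r : (Fin (N + 1) → U) → S → X → Y → Z → Fin (N + 1) → ℝ := fun C s x y z m =>
    pS s * PX (C m) s x * V x y * PZ (C m) y z * G s x y z *
      (L (C m) s / ∑ j, L (C j) s) * (K (C m) y / ∑ j, K (C j) y) with hr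
  have havg : ∑ s, ∑ x, ∑ y, ∑ z, ∑ u, pU u * pS s * L u s * PX u s x * V x y * PZ u y z *
      (G s x y z * (((N + 1) / (L u s + N)) * (K u y / (K u y + N)))) ≤
      ∑ C : Fin (N + 1) → U, (∏ i, pU (C i)) * ∑ s, ∑ x, ∑ y, ∑ z, ∑ m, r C s x y z m := by
    simp_rw [Finset.mul_sum]
    rw [Finset.sum_comm (s := (Finset.univ : Finset (Fin (N + 1) → U)))]
    refine Finset.sum_le_sum fun s _ => ?_
    rw [Finset.sum_comm (s := (Finset.univ : Finset (Fin (N + 1) → U)))]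
    refine Finset.sum_le_sum fun x _ => ?_
    rw [Finset.sum_comm (s := (Finset.univ : Finset (Fin (N + 1) → U)))]
    refine Finset.sum_le_sum fun y _ => ?_
    rw [Finset.sum_comm (s := (Finset.univ : Finset (Fin (N + 1) → U)))]
    refine Finset.sum_le_sum fun z _ => ?_
    have h := le_sum_codebook hpU (L := fun u => L u s) (K := fun u => K u y)
      (c := fun u => pS s * PX u s x * V x y * PZ u y z * G s x y z)
      (fun u => hL u s) (fun u => hK u y)
      (fun u => mul_nonneg (mul_nonneg (mul_nonneg (mul_nonneg (hpS s) ((hPX u s).1 x))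
        (hV x y)) ((hPZ u y).1 z)) (hG s x y z)) (hL1 s) (hK1 y) N
    refine le_trans (le_of_eq ?_) (h.trans (le_of_eq ?_))
    · exact Finset.sum_congr rfl fun u _ => by ring
    · exact Finset.sum_congr rfl fun C _ => by rw [Finset.mul_sum]
  obtain ⟨C, hC⟩ : ∃ C, ∑ C : Fin (N + 1) → U, (∏ i, pU (C i)) *
      ∑ s, ∑ x, ∑ y, ∑ z, ∑ m, r C s x y z m ≤ ∑ s, ∑ x, ∑ y, ∑ z, ∑ m, r C s x y z m := by
    have hw := IsPMF.prod_pi (fun _ : Fin (N + 1) => hpU)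
    have : Nonempty (Fin (N + 1) → U) := by
      by_contra h
      rw [not_nonempty_iff] at h
      simpa using hw.2
    refine exists_sum_mul_le hw.1 hw.2.le fun C => ?_
    refine Finset.sum_nonneg fun s _ => Finset.sum_nonneg fun x _ => Finset.sum_nonneg fun y _ =>
      Finset.sum_nonneg fun z _ => Finset.sum_nonneg fun m _ => ?_
    exact mul_nonneg (mul_nonneg (mul_nonneg (mul_nonneg (mul_nonneg (mul_nonneg (hpS s)
      ((hPX _ s).1 x)) (hV x y)) ((hPZ _ y).1 z)) (hG s x y z))
      (div_nonneg (hL _ s) (Finset.sum_nonneg fun j _ => hL _ s)))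
      (div_nonneg (hK _ y) (Finset.sum_nonneg fun j _ => hK _ y))
  obtain ⟨f, g, hfg⟩ := exists_deterministic_code (pS := pS) (V := V) (G := G)
    (W := fun s x => ∑ m, L (C m) s / (∑ j, L (C j) s) * PX (C m) s x)
    (D := fun y z => ∑ m, K (C m) y / (∑ j, K (C j) y) * PZ (C m) y z)
    hpS (fun s x => Finset.sum_nonneg fun m _ => mul_nonneg (codeword_weight_nonneg hL C m s) ((hPX _ s).1 x))
    (sum_codeword_mixture_le_one C L hPX) hV
    (fun y z => Finset.sum_nonneg fun m _ => mul_nonneg (codeword_weight_nonneg hK C m y) ((hPZ _ y).1 z))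
    (sum_codeword_mixture_le_one C K hPZ) hG
  refine ⟨f, g, havg.trans (hC.trans (le_trans ?_ hfg))⟩
  refine Finset.sum_le_sum fun s _ => Finset.sum_le_sum fun x _ => Finset.sum_le_sum fun y _ =>
    Finset.sum_le_sum fun z _ => ?_
  have e : pS s * (∑ m, L (C m) s / (∑ j, L (C j) s) * PX (C m) s x) * V x y *
      (∑ m, K (C m) y / (∑ j, K (C j) y) * PZ (C m) y z) * G s x y z =
      ∑ m, pS s * V x y * G s x y z * ((L (C m) s / (∑ j, L (C j) s) * PX (C m) s x) *
        ∑ m, K (C m) y / (∑ j, K (C j) y) * PZ (C m) y z) := by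
    rw [← Finset.mul_sum, ← Finset.sum_mul]; ring
  rw [e]
  refine Finset.sum_le_sum fun m _ => ?_
  have h1 : K (C m) y / (∑ j, K (C j) y) * PZ (C m) y z ≤
      ∑ m, K (C m) y / (∑ j, K (C j) y) * PZ (C m) y z :=
    Finset.single_le_sum (f := fun m => K (C m) y / (∑ j, K (C j) y) * PZ (C m) y z)
      (fun m _ => mul_nonneg (codeword_weight_nonneg hK C m y) ((hPZ _ y).1 z)) (Finset.mem_univ m)
  refine le_trans (le_of_eq ?_) (mul_le_mul_of_nonneg_left (mul_le_mul_of_nonneg_left h1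
    (mul_nonneg (codeword_weight_nonneg hL C m s) ((hPX _ s).1 x)))
    (mul_nonneg (mul_nonneg (hpS s) (hV x y)) (hG s x y z)))
  simp only [hr]; ring

end OneShot

section LikelihoodRatio

variable {Ω A B : Type*} [Fintype Ω] {P : Ω → ℝ}

lemma sum_margProb_mul [Fintype A] (P : Ω → ℝ) (f : Ω → A) (φ : A → ℝ) :
    ∑ a, margProb P f a * φ a = ∑ ω, P ω * φ (f ω) := by
  classical
  simp_rw [margProb, prob, Finset.sum_mul]
  rw [Finset.sum_comm]
  refine Finset.sum_congr rfl fun ω _ => ?_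
  rw [Finset.sum_eq_single (f ω) (fun a _ h => by simp [h.symm]) (by simp)]
  simp

lemma isPMF_margProb [Fintype A] (hP : IsPMF P) (f : Ω → A) : IsPMF (margProb P f) :=
  ⟨fun _ => Finset.sum_nonneg fun _ _ => Set.indicator_nonneg (fun _ _ => hP.1 _) _, by
    simpa [hP.2] using sum_margProb_mul P f fun _ => 1⟩

lemma margProb_pos (hP : IsPMF P) (f : Ω → A) {ω : Ω} (hω : 0 < P ω) : 0 < margProb P f (f ω) :=
  Finset.sum_pos' (fun _ _ => Set.indicator_nonneg (fun _ _ => hP.1 _) _)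
    ⟨ω, Finset.mem_univ _, by simpa using hω⟩

lemma sum_margProb_pair [Fintype A] [Fintype B] (f : Ω → A) (g : Ω → B) (b : B) :
    ∑ a, margProb P (fun ω => (f ω, g ω)) (a, b) = margProb P g b := by
  classical
  simp_rw [margProb, prob]
  rw [Finset.sum_comm]
  refine Finset.sum_congr rfl fun ω _ => ?_
  rw [Finset.sum_eq_single (f ω) (fun a _ h => by simp [h.symm]) (by simp)]
  by_cases h : g ω = b <;> simp [h]

lemma sum_margProb_pair_right [Fintype A] [Fintype B] (f : Ω → A) (g : Ω → B) (a : A) :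
    ∑ b, margProb P (fun ω => (f ω, g ω)) (a, b) = margProb P f a := by
  rw [← sum_margProb_pair g f a]
  refine Finset.sum_congr rfl fun b _ => congrArg (prob P) (Set.ext fun ω => ?_)
  simp [and_comm]

lemma margProb_pair_le_left (hP : IsPMF P) (f : Ω → A) (g : Ω → B) (a : A) (b : B) :
    margProb P (fun ω => (f ω, g ω)) (a, b) ≤ margProb P f a :=
  prob_mono hP.1 fun _ h => congrArg Prod.fst h

lemma margProb_pair_le_right (hP : IsPMF P) (f : Ω → A) (g : Ω → B) (a : A) (b : B) :
    margProb P (fun ω => (f ω, g ω)) (a, b) ≤ margProb P g b :=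
  prob_mono hP.1 fun _ h => congrArg Prod.snd h

/-- The density of the joint law of `(f, g)` with respect to the product of its marginals. -/
def likelihoodRatio (P : Ω → ℝ) (f : Ω → A) (g : Ω → B) (a : A) (b : B) : ℝ :=
  margProb P (fun ω => (f ω, g ω)) (a, b) / (margProb P f a * margProb P g b)

lemma margProb_nonneg (hP : IsPMF P) (f : Ω → A) (a : A) : 0 ≤ margProb P f a :=
  Finset.sum_nonneg fun _ _ => Set.indicator_nonneg (fun _ _ => hP.1 _) _

lemma likelihoodRatio_nonneg (hP : IsPMF P) (f : Ω → A) (g : Ω → B) (a : A) (b : B) :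
    0 ≤ likelihoodRatio P f g a b :=
  div_nonneg (margProb_nonneg hP _ _) (mul_nonneg (margProb_nonneg hP _ _)
    (margProb_nonneg hP _ _))

lemma likelihoodRatio_pos (hP : IsPMF P) (f : Ω → A) (g : Ω → B) {ω : Ω} (hω : 0 < P ω) :
    0 < likelihoodRatio P f g (f ω) (g ω) :=
  div_pos (margProb_pos hP (fun ω => (f ω, g ω)) hω)
    (mul_pos (margProb_pos hP f hω) (margProb_pos hP g hω))

lemma margProb_mul_likelihoodRatio (hP : IsPMF P) (f : Ω → A) (g : Ω → B) (a : A) (b : B) :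
    margProb P f a * margProb P g b * likelihoodRatio P f g a b =
      margProb P (fun ω => (f ω, g ω)) (a, b) := by
  refine mul_div_cancel_of_imp' fun h => le_antisymm ?_ (margProb_nonneg hP _ _)
  rcases mul_eq_zero.1 h with h | h
  · exact h ▸ margProb_pair_le_left hP f g a b
  · exact h ▸ margProb_pair_le_right hP f g a b

lemma sum_margProb_mul_likelihoodRatio_le_one [Fintype A] [Fintype B] (hP : IsPMF P) (f : Ω → A)
    (g : Ω → B) (b : B) : ∑ a, margProb P f a * likelihoodRatio P f g a b ≤ 1 := by
  have h : ∀ a, margProb P f a * likelihoodRatio P f g a b ≤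
      margProb P (fun ω => (f ω, g ω)) (a, b) / margProb P g b := by
    intro a
    rcases eq_or_ne (margProb P g b) 0 with h0 | h0
    · simp [likelihoodRatio, h0]
    · rw [le_div_iff₀ ((margProb_nonneg hP g b).lt_of_ne' h0),
        ← margProb_mul_likelihoodRatio hP f g a b]
      exact le_of_eq (by ring)
  refine (Finset.sum_le_sum fun a _ => h a).trans ?_
  rw [← Finset.sum_div, sum_margProb_pair]
  exact div_self_le_one _

lemma mutInfo_eq_sum [Fintype A] [Fintype B] (f : Ω → A) (g : Ω → B) :
    mutInfo P f g = (∑ ω, P ω * Real.log (likelihoodRatio P f g (f ω) (g ω))) / Real.log 2 := by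
  have h := sum_margProb_mul P (fun ω => (f ω, g ω))
    (fun ab => Real.log (likelihoodRatio P f g ab.1 ab.2))
  rw [← h, Fintype.sum_prod_type, Finset.sum_div]
  refine Finset.sum_congr rfl fun a _ => ?_
  rw [Finset.sum_div]
  refine Finset.sum_congr rfl fun b _ => ?_
  rw [mul_div_assoc]
  rfl

lemma sum_mul_klFun_likelihoodRatio [Fintype A] [Fintype B] (hP : IsPMF P) (f : Ω → A)
    (g : Ω → B) :
    ∑ a, ∑ b, margProb P f a * margProb P g b *
      InformationTheory.klFun (likelihoodRatio P f g a b) = mutInfo P f g * Real.log 2 := by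
  have hlog2 : Real.log 2 ≠ 0 := (Real.log_pos one_lt_two).ne'
  have e : ∀ a b, margProb P f a * margProb P g b *
      InformationTheory.klFun (likelihoodRatio P f g a b) =
      margProb P (fun ω => (f ω, g ω)) (a, b) * Real.log (likelihoodRatio P f g a b) +
        margProb P f a * margProb P g b - margProb P (fun ω => (f ω, g ω)) (a, b) := by
    intro a b
    rw [← margProb_mul_likelihoodRatio hP f g a b, InformationTheory.klFun]
    ring
  simp_rw [e, Finset.sum_sub_distrib, Finset.sum_add_distrib, ← Finset.mul_sum,
    (isPMF_margProb hP g).2, mul_one, (isPMF_margProb hP f).2]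
  rw [Finset.sum_comm (f := fun a b => margProb P (fun ω => (f ω, g ω)) (a, b))]
  simp_rw [sum_margProb_pair, (isPMF_margProb hP g).2, mutInfo, Finset.sum_mul]
  rw [add_sub_cancel_right]
  refine Finset.sum_congr rfl fun a _ => Finset.sum_congr rfl fun b _ => ?_
  rw [Real.logb, mul_assoc, div_mul_cancel₀ _ hlog2]
  rfl

lemma mutInfo_nonneg [Fintype A] [Fintype B] (hP : IsPMF P) (f : Ω → A) (g : Ω → B) :
    0 ≤ mutInfo P f g := by
  refine nonneg_of_mul_nonneg_left ?_ (Real.log_pos one_lt_two)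
  rw [← sum_mul_klFun_likelihoodRatio hP]
  exact Finset.sum_nonneg fun a _ => Finset.sum_nonneg fun b _ =>
    mul_nonneg (mul_nonneg (margProb_nonneg hP f a) (margProb_nonneg hP g b))
      (InformationTheory.klFun_nonneg (likelihoodRatio_nonneg hP f g a b))

lemma likelihoodRatio_eq_one_of_mutInfo_eq_zero [Fintype A] [Fintype B] (hP : IsPMF P)
    {f : Ω → A} {g : Ω → B} (h : mutInfo P f g = 0) {ω : Ω} (hω : 0 < P ω) :
    likelihoodRatio P f g (f ω) (g ω) = 1 := by
  have hnn : ∀ a b, 0 ≤ margProb P f a * margProb P g b *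
      InformationTheory.klFun (likelihoodRatio P f g a b) := fun a b =>
    mul_nonneg (mul_nonneg (margProb_nonneg hP f a) (margProb_nonneg hP g b))
      (InformationTheory.klFun_nonneg (likelihoodRatio_nonneg hP f g a b))
  have hs := sum_mul_klFun_likelihoodRatio hP f g
  rw [h, zero_mul, Finset.sum_eq_zero_iff_of_nonneg
    fun a _ => Finset.sum_nonneg fun b _ => hnn a b] at hs
  have hs' := (Finset.sum_eq_zero_iff_of_nonneg fun b _ => hnn (f ω) b).1
    (hs (f ω) (Finset.mem_univ _)) (g ω) (Finset.mem_univ _)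
  have hpos := mul_pos (margProb_pos hP f hω) (margProb_pos hP g hω)
  exact (InformationTheory.klFun_eq_zero_iff (likelihoodRatio_nonneg hP f g _ _)).1
    ((mul_eq_zero.1 hs').resolve_left hpos.ne')

end LikelihoodRatio

section BlockCoding

lemma IsPMF.nonempty {A : Type*} [Fintype A] {p : A → ℝ} (hp : IsPMF p) : Nonempty A := by
  by_contra h
  rw [not_nonempty_iff] at h
  simpa using hp.2

lemma isPMF_inducedP {S X Y : Type*} [Fintype S] [Fintype Y] {n : ℕ} {PS : S → ℝ}
    {PYX : X → Y → ℝ} (hPS : IsPMF PS) (hPYX : ∀ x, IsPMF (PYX x))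
    (f : Fin n → (Fin n → S) → X) : IsPMF (inducedP PS PYX f) := by
  have h1 := IsPMF.prod_pi (fun _ : Fin n => hPS)
  have h2 := fun s => IsPMF.prod_pi (fun i : Fin n => hPYX (f i s))
  refine ⟨fun sy => mul_nonneg (h1.1 _) ((h2 _).1 _), ?_⟩
  simp_rw [inducedP, Fintype.sum_prod_type, ← Finset.mul_sum, (h2 _).2, mul_one]
  exact h1.2

lemma exists_prob_typical_gt {A B : Type*} [Fintype A] [Fintype B] {Q : A → ℝ} (hQ : IsPMF Q)
    (π : A → B) {ε δ : ℝ} (hε : 0 < ε) (hδ : 0 < δ) :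
    ∃ n₀ : ℕ, ∀ n ≥ n₀, 1 - δ < prob (fun ω : Fin n → A => ∏ i, Q (ω i))
      {ω | tvDist (empDist fun i => π (ω i)) (margProb Q π) ≤ ε} := by
  have hη : 0 < ε / (Fintype.card B + 1) := by positivity
  obtain ⟨n₀, h⟩ := exists_prob_iid_gt hQ
    (fun (b : B) a => ({a | π a = b} : Set A).indicator (fun _ => (1 : ℝ)) a) hη hδ
  refine ⟨n₀ + 1, fun n hn => h n (by omega) _ fun ω _ hω => ?_⟩
  have hn0 : (0 : ℝ) < n := by exact_mod_cast (show 0 < n by omega)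
  have hb : ∀ b, |empDist (fun i => π (ω i)) b - margProb Q π b| ≤ ε / (Fintype.card B + 1) := by
    intro b
    have hm : ∑ a, Q a * ({a | π a = b} : Set A).indicator (fun _ => (1 : ℝ)) a =
        margProb Q π b := Finset.sum_congr rfl fun a _ => by
      by_cases h : π a = b <;> simp [h]
    have hω' := hω b
    rw [hm] at hω'
    have e : empDist (fun i => π (ω i)) b - margProb Q π b =
        (∑ i, ({a | π a = b} : Set A).indicator (fun _ => (1 : ℝ)) (ω i) -
          n * margProb Q π b) / n := by
      rw [sub_div, mul_div_cancel_left₀ _ hn0.ne']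
      rfl
    rw [e, abs_div, abs_of_pos hn0, div_le_iff₀ hn0, mul_comm _ (n : ℝ)]
    exact hω'
  have hsum := Finset.sum_le_sum fun b (_ : b ∈ Finset.univ) => hb b
  rw [Finset.sum_const, Finset.card_univ, nsmul_eq_mul] at hsum
  have hle : (Fintype.card B : ℝ) * (ε / (Fintype.card B + 1)) ≤ ε := by
    rw [mul_div_assoc', div_le_iff₀ (by positivity)]
    nlinarith
  simp only [Set.mem_ofPred_eq, tvDist]
  linarith

lemma sum_iid_mul_prod_le_one {U B ι : Type*} [Fintype U] [Fintype ι] [DecidableEq ι] {pU : U → ℝ}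
    {F : U → B → ℝ} (hpU : ∀ u, 0 ≤ pU u) (hF : ∀ u b, 0 ≤ F u b)
    (hF1 : ∀ b, ∑ u, pU u * F u b ≤ 1) (b : ι → B) :
    ∑ u : ι → U, (∏ i, pU (u i)) * ∏ i, F (u i) (b i) ≤ 1 := by
  simp_rw [← Finset.prod_mul_distrib]
  rw [sum_pi_prod fun i u => pU u * F u (b i)]
  exact Finset.prod_le_one (fun i _ => Finset.sum_nonneg fun u _ =>
    mul_nonneg (hpU u) (hF u _)) fun i _ => hF1 _

/-- Achievability, provided the one-shot success factors of the block codes tend to one. -/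
lemma achievable_of_success_factors {S X Y Z U : Type*} [Fintype S] [Fintype X] [Fintype Y]
    [Fintype Z] [Fintype U] {PS : S → ℝ} {PYX : X → Y → ℝ} (hPS : IsPMF PS)
    (hPYX : ∀ x, IsPMF (PYX x)) {pU : U → ℝ} {PX : U → S → X → ℝ} {PZ : U → Y → Z → ℝ}
    {L : U → S → ℝ} {K : U → Y → ℝ} (hpU : IsPMF pU) (hPX : ∀ u s, IsPMF (PX u s))
    (hPZ : ∀ u y, IsPMF (PZ u y))
    (hL : ∀ u s, 0 ≤ L u s) (hL1 : ∀ s, ∑ u, pU u * L u s ≤ 1)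
    (hK : ∀ u y, 0 ≤ K u y) (hK1 : ∀ y, ∑ u, pU u * K u y ≤ 1)
    {Q : S × X × Y × Z × U → ℝ} (hQpmf : IsPMF Q)
    (hQ : ∀ s x y z u, Q (s, x, y, z, u) =
      pU u * PS s * L u s * PX u s x * PYX x y * PZ u y z)
    {P : S × X × Y × Z → ℝ} (hP : ∀ s x y z, P (s, x, y, z) = ∑ u, Q (s, x, y, z, u))
    (H : ∀ δ : ℝ, 0 < δ → ∃ n₀ : ℕ, ∀ n ≥ n₀, ∃ N : ℕ,
      1 - δ < prob (fun ω : Fin n → S × X × Y × Z × U => ∏ i, Q (ω i))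
        {ω | 1 - δ ≤ (N + 1) / (∏ i, L (ω i).2.2.2.2 (ω i).1 + N) *
          ((∏ i, K (ω i).2.2.2.2 (ω i).2.2.1) / (∏ i, K (ω i).2.2.2.2 (ω i).2.2.1 + N))}) :
    Achievable PS PYX EncoderClass.noncausal P := by
  classical
  intro ε hε
  obtain ⟨s₀⟩ := hPS.nonempty
  obtain ⟨u₀⟩ := hpU.nonempty
  have hX : Nonempty X := (hPX u₀ s₀).nonempty
  obtain ⟨y₀⟩ := (hPYX hX.some).nonempty
  have hZ : Nonempty Z := (hPZ u₀ y₀).nonempty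
  set δ : ℝ := min ε 1 / 3 with hδ
  have hδ0 : 0 < δ := by positivity
  have hδε : 3 * δ ≤ ε := by rw [hδ]; linarith [min_le_left ε 1]
  have hδ1 : 3 * δ ≤ 1 := by rw [hδ]; linarith [min_le_right ε 1]
  let π : S × X × Y × Z × U → S × X × Y × Z := fun a => (a.1, a.2.1, a.2.2.1, a.2.2.2.1)
  have hPm : margProb Q π = P := by
    funext ⟨s, x, y, z⟩
    rw [hP, margProb, prob]
    simp_rw [Fintype.sum_prod_type]
    rw [Finset.sum_eq_single s (fun _ _ h => by simp [π, h]) (by simp),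
      Finset.sum_eq_single x (fun _ _ h => by simp [π, h]) (by simp),
      Finset.sum_eq_single y (fun _ _ h => by simp [π, h]) (by simp),
      Finset.sum_eq_single z (fun _ _ h => by simp [π, h]) (by simp)]
    simp [π]
  obtain ⟨n₁, h₁⟩ := exists_prob_typical_gt hQpmf π hε hδ0
  obtain ⟨n₂, h₂⟩ := H δ hδ0
  set n := n₁ + n₂ + 1 with hn
  obtain ⟨N, hN⟩ := h₂ n (by omega)
  have hty := h₁ n (by omega)
  rw [hPm] at hty
  let G : (Fin n → S) → (Fin n → X) → (Fin n → Y) → (Fin n → Z) → ℝ := fun s x y z =>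
    if tvDist (empDist fun i => (s i, x i, y i, z i)) P ≤ ε then 1 else 0
  have hG : ∀ s x y z, 0 ≤ G s x y z := fun s x y z => by simp only [G]; split_ifs <;> simp
  obtain ⟨f, g, hfg⟩ := exists_oneShot_code
    (pU := fun u : Fin n → U => ∏ i, pU (u i)) (pS := fun s : Fin n → S => ∏ i, PS (s i))
    (L := fun u s => ∏ i, L (u i) (s i)) (K := fun u y => ∏ i, K (u i) (y i))
    (PX := fun u s x => ∏ i, PX (u i) (s i) (x i)) (V := fun x y => ∏ i, PYX (x i) (y i))
    (PZ := fun u y z => ∏ i, PZ (u i) (y i) (z i)) (G := G)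
    (IsPMF.prod_pi fun _ => hpU) (fun s => Finset.prod_nonneg fun i _ => hPS.1 _)
    (fun u s => Finset.prod_nonneg fun i _ => hL _ _) (sum_iid_mul_prod_le_one hpU.1 hL hL1)
    (fun u y => Finset.prod_nonneg fun i _ => hK _ _) (sum_iid_mul_prod_le_one hpU.1 hK hK1)
    (fun u s => IsPMF.prod_pi fun i => hPX (u i) (s i))
    (fun x y => Finset.prod_nonneg fun i _ => (hPYX _).1 _)
    (fun u y => IsPMF.prod_pi fun i => hPZ (u i) (y i)) hG N
  set w : (Fin n → S × X × Y × Z × U) → ℝ := fun ω => ∏ i, Q (ω i) with hw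
  have hwpmf : IsPMF w := IsPMF.prod_pi fun _ => hQpmf
  set Φ : (Fin n → S × X × Y × Z × U) → ℝ := fun ω =>
    (N + 1) / (∏ i, L (ω i).2.2.2.2 (ω i).1 + N) *
      ((∏ i, K (ω i).2.2.2.2 (ω i).2.2.1) / (∏ i, K (ω i).2.2.2.2 (ω i).2.2.1 + N)) with hΦ
  have hΦ0 : ∀ ω, 0 ≤ Φ ω := fun ω => by
    have h1 : 0 ≤ ∏ i, L (ω i).2.2.2.2 (ω i).1 := Finset.prod_nonneg fun i _ => hL _ _
    have h2 : 0 ≤ ∏ i, K (ω i).2.2.2.2 (ω i).2.2.1 := Finset.prod_nonneg fun i _ => hK _ _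
    simp only [hΦ]; positivity
  set T : Set (Fin n → S × X × Y × Z × U) :=
    {ω | tvDist (empDist fun i => π (ω i)) P ≤ ε} with hT
  have hlow : (1 - δ) * (1 - 2 * δ) < ∑ ω, w ω *
      (G (fun i => (ω i).1) (fun i => (ω i).2.1) (fun i => (ω i).2.2.1)
        (fun i => (ω i).2.2.2.1) * Φ ω) := by
    have h1 : 1 - 2 * δ < prob w (T ∩ {ω | 1 - δ ≤ Φ ω}) := by
      linarith [add_prob_sub_one_le_prob_inter hwpmf T {ω | 1 - δ ≤ Φ ω}]
    refine (mul_lt_mul_of_pos_left h1 (by linarith)).trans_le ?_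
    rw [prob, Finset.mul_sum]
    refine Finset.sum_le_sum fun ω _ => ?_
    by_cases hω : ω ∈ T ∩ {ω | 1 - δ ≤ Φ ω}
    · have hG1 : G (fun i => (ω i).1) (fun i => (ω i).2.1) (fun i => (ω i).2.2.1)
        (fun i => (ω i).2.2.2.1) = 1 := if_pos hω.1
      rw [Set.indicator_of_mem hω, hG1, one_mul, mul_comm]
      exact mul_le_mul_of_nonneg_left hω.2 (hwpmf.1 ω)
    · rw [Set.indicator_of_notMem hω, mul_zero]
      exact mul_nonneg (hwpmf.1 ω) (mul_nonneg (hG _ _ _ _) (hΦ0 ω))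
  have hsum : ∑ ω, w ω * (G (fun i => (ω i).1) (fun i => (ω i).2.1) (fun i => (ω i).2.2.1)
        (fun i => (ω i).2.2.2.1) * Φ ω) ≤
      ∑ s, ∑ y, (∏ i, PS (s i)) * (∏ i, PYX (f s i) (y i)) * G s (f s) y (g y) := by
    refine le_trans (le_of_eq ?_) hfg
    rw [sum_arrow_prod]
    refine Finset.sum_congr rfl fun s _ => ?_
    rw [sum_arrow_prod]
    refine Finset.sum_congr rfl fun x _ => ?_
    rw [sum_arrow_prod]
    refine Finset.sum_congr rfl fun y _ => ?_
    rw [sum_arrow_prod]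
    refine Finset.sum_congr rfl fun z _ => Finset.sum_congr rfl fun u _ => ?_
    simp only [hw, hΦ, hQ, Finset.prod_mul_distrib]
  refine ⟨n, by omega, fun i s => f s i, fun i y => g y i, trivial, ?_⟩
  have hind := isPMF_inducedP hPS hPYX (fun i s => f s i)
  have hgood : ∑ s, ∑ y, (∏ i, PS (s i)) * (∏ i, PYX (f s i) (y i)) * G s (f s) y (g y) =
      prob (inducedP PS PYX fun i s => f s i)
        {sy | ε < tvDist (empDist fun i => (sy.1 i, f sy.1 i, sy.2 i, g sy.2 i)) P}ᶜ := by
    rw [prob, Fintype.sum_prod_type]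
    refine Finset.sum_congr rfl fun s _ => Finset.sum_congr rfl fun y _ => ?_
    by_cases h : tvDist (empDist fun i => (s i, f s i, y i, g y i)) P ≤ ε
    · rw [Set.indicator_of_mem (by simpa using h)]
      simp [G, h, inducedP]
    · rw [Set.indicator_of_notMem (by simpa using h)]
      simp [G, h]
  rw [prob_compl hind] at hgood
  nlinarith

end BlockCoding

section CoordinationKernels

variable {S X Y Z U : Type*} [Fintype S] [Fintype X] [Fintype Y] [Fintype Z] [Fintype U]

/-- The joint law of `(S, X, Y, Ŝ, U)` built from the source, the channel and the kernels
`P_{U|S}`, `P_{X|US}`, `P_{Ŝ|UY}`. -/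
def jointLaw (PS : S → ℝ) (PYX : X → Y → ℝ) (PUgS : S → U → ℝ) (PXgUS : U → S → X → ℝ)
    (PZgUY : U → Y → Z → ℝ) : S × X × Y × Z × U → ℝ :=
  fun ω => PS ω.1 * PUgS ω.1 ω.2.2.2.2 * PXgUS ω.2.2.2.2 ω.1 ω.2.1 * PYX ω.2.1 ω.2.2.1 *
    PZgUY ω.2.2.2.2 ω.2.2.1 ω.2.2.2.1

variable {PS : S → ℝ} {PYX : X → Y → ℝ} {PUgS : S → U → ℝ} {PXgUS : U → S → X → ℝ}
  {PZgUY : U → Y → Z → ℝ}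

lemma margProb_jointLaw_us (hPYX : ∀ x, IsPMF (PYX x)) (hPXgUS : ∀ u s, IsPMF (PXgUS u s))
    (hPZgUY : ∀ u y, IsPMF (PZgUY u y)) (u : U) (s : S) :
    margProb (jointLaw PS PYX PUgS PXgUS PZgUY) (fun ω => (ω.2.2.2.2, ω.1)) (u, s) =
      PS s * PUgS s u := by
  classical
  rw [margProb, prob]
  simp_rw [Fintype.sum_prod_type]
  rw [Finset.sum_eq_single s (fun _ _ h => by simp [h]) (by simp)]
  have h : ∀ x y z, ∑ u', ({ω : S × X × Y × Z × U | (ω.2.2.2.2, ω.1) = (u, s)}).indicator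
      (jointLaw PS PYX PUgS PXgUS PZgUY) (s, x, y, z, u') =
      PS s * PUgS s u * PXgUS u s x * PYX x y * PZgUY u y z := fun x y z => by
    rw [Finset.sum_eq_single u (fun _ _ h => by simp [h]) (by simp)]
    simp [jointLaw]
  simp_rw [h, ← Finset.mul_sum, (hPZgUY _ _).2, mul_one, ← Finset.mul_sum, (hPYX _).2, mul_one,
    ← Finset.mul_sum, (hPXgUS _ _).2, mul_one]

lemma margProb_jointLaw_uy (hPZgUY : ∀ u y, IsPMF (PZgUY u y)) (u : U) (y : Y) :
    margProb (jointLaw PS PYX PUgS PXgUS PZgUY) (fun ω => (ω.2.2.2.2, ω.2.2.1)) (u, y) =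
      ∑ s, ∑ x, PS s * PUgS s u * PXgUS u s x * PYX x y := by
  classical
  rw [margProb, prob]
  simp_rw [Fintype.sum_prod_type]
  refine Finset.sum_congr rfl fun s _ => Finset.sum_congr rfl fun x _ => ?_
  rw [Finset.sum_eq_single y (fun _ _ h => by simp [h]) (by simp)]
  have h : ∀ z, ∑ u', ({ω : S × X × Y × Z × U | (ω.2.2.2.2, ω.2.2.1) = (u, y)}).indicator
      (jointLaw PS PYX PUgS PXgUS PZgUY) (s, x, y, z, u') =
      PS s * PUgS s u * PXgUS u s x * PYX x y * PZgUY u y z := fun z => by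
    rw [Finset.sum_eq_single u (fun _ _ h => by simp [h]) (by simp)]
    simp [jointLaw]
  simp_rw [h, ← Finset.mul_sum, (hPZgUY _ _).2, mul_one]

lemma margProb_jointLaw_u (hPYX : ∀ x, IsPMF (PYX x)) (hPXgUS : ∀ u s, IsPMF (PXgUS u s))
    (hPZgUY : ∀ u y, IsPMF (PZgUY u y)) (u : U) :
    margProb (jointLaw PS PYX PUgS PXgUS PZgUY) (fun ω => ω.2.2.2.2) u =
      ∑ s, PS s * PUgS s u := by
  rw [← sum_margProb_pair_right (fun ω : S × X × Y × Z × U => ω.2.2.2.2) fun ω => ω.1]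
  simp_rw [margProb_jointLaw_us hPYX hPXgUS hPZgUY]

lemma margProb_jointLaw_s (hPYX : ∀ x, IsPMF (PYX x)) (hPUgS : ∀ s, IsPMF (PUgS s))
    (hPXgUS : ∀ u s, IsPMF (PXgUS u s)) (hPZgUY : ∀ u y, IsPMF (PZgUY u y)) (s : S) :
    margProb (jointLaw PS PYX PUgS PXgUS PZgUY) (fun ω => ω.1) s = PS s := by
  rw [← sum_margProb_pair (fun ω : S × X × Y × Z × U => ω.2.2.2.2) fun ω => ω.1]
  simp_rw [margProb_jointLaw_us hPYX hPXgUS hPZgUY, ← Finset.mul_sum, (hPUgS s).2, mul_one]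

lemma margProb_jointLaw_y (hPZgUY : ∀ u y, IsPMF (PZgUY u y)) (y : Y) :
    margProb (jointLaw PS PYX PUgS PXgUS PZgUY) (fun ω => ω.2.2.1) y =
      ∑ u, ∑ s, ∑ x, PS s * PUgS s u * PXgUS u s x * PYX x y := by
  rw [← sum_margProb_pair (fun ω : S × X × Y × Z × U => ω.2.2.2.2) fun ω => ω.2.2.1]
  simp_rw [margProb_jointLaw_uy hPZgUY]

lemma isPMF_jointLaw (hPS : IsPMF PS) (hPYX : ∀ x, IsPMF (PYX x)) (hPUgS : ∀ s, IsPMF (PUgS s))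
    (hPXgUS : ∀ u s, IsPMF (PXgUS u s)) (hPZgUY : ∀ u y, IsPMF (PZgUY u y)) :
    IsPMF (jointLaw PS PYX PUgS PXgUS PZgUY) := by
  refine ⟨fun ω => mul_nonneg (mul_nonneg (mul_nonneg (mul_nonneg (hPS.1 _) ((hPUgS _).1 _))
    ((hPXgUS _ _).1 _)) ((hPYX _).1 _)) ((hPZgUY _ _).1 _), ?_⟩
  have h := sum_margProb_mul (jointLaw PS PYX PUgS PXgUS PZgUY) (fun ω => ω.1) fun _ => 1
  simp_rw [mul_one, margProb_jointLaw_s hPYX hPUgS hPXgUS hPZgUY] at h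
  rw [← h, hPS.2]

lemma achievable_of_likelihoodRatio_factors (hPS : IsPMF PS) (hPYX : ∀ x, IsPMF (PYX x))
    (hPUgS : ∀ s, IsPMF (PUgS s)) (hPXgUS : ∀ u s, IsPMF (PXgUS u s))
    (hPZgUY : ∀ u y, IsPMF (PZgUY u y))
    (H : ∀ δ : ℝ, 0 < δ → ∃ n₀ : ℕ, ∀ n ≥ n₀, ∃ N : ℕ, ∃ T : Set (Fin n → S × X × Y × Z × U),
      1 - δ < prob (fun ω => ∏ i, jointLaw PS PYX PUgS PXgUS PZgUY (ω i)) T ∧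
      ∀ ω ∈ T, 1 - δ ≤ (N + 1) /
        (∏ i, likelihoodRatio (jointLaw PS PYX PUgS PXgUS PZgUY) (fun ω => ω.2.2.2.2)
          (fun ω => ω.1) (ω i).2.2.2.2 (ω i).1 + N) *
        ((∏ i, likelihoodRatio (jointLaw PS PYX PUgS PXgUS PZgUY) (fun ω => ω.2.2.2.2)
          (fun ω => ω.2.2.1) (ω i).2.2.2.2 (ω i).2.2.1) /
        (∏ i, likelihoodRatio (jointLaw PS PYX PUgS PXgUS PZgUY) (fun ω => ω.2.2.2.2)
          (fun ω => ω.2.2.1) (ω i).2.2.2.2 (ω i).2.2.1 + N))) :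
    Achievable PS PYX EncoderClass.noncausal
      fun a => ∑ u, jointLaw PS PYX PUgS PXgUS PZgUY (a.1, a.2.1, a.2.2.1, a.2.2.2, u) := by
  have hQ := isPMF_jointLaw hPS hPYX hPUgS hPXgUS hPZgUY
  refine achievable_of_success_factors hPS hPYX (isPMF_margProb hQ fun ω => ω.2.2.2.2)
    hPXgUS hPZgUY (fun u s => likelihoodRatio_nonneg hQ (fun ω => ω.2.2.2.2) (fun ω => ω.1) u s)
    (fun s => sum_margProb_mul_likelihoodRatio_le_one hQ _ _ s)
    (fun u y => likelihoodRatio_nonneg hQ (fun ω => ω.2.2.2.2) (fun ω => ω.2.2.1) u y)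
    (fun y => sum_margProb_mul_likelihoodRatio_le_one hQ _ _ y) hQ ?_ (fun _ _ _ _ => rfl) ?_
  · intro s x y z u
    have h := margProb_mul_likelihoodRatio hQ (fun ω => ω.2.2.2.2) (fun ω => ω.1) u s
    rw [margProb_jointLaw_us hPYX hPXgUS hPZgUY,
      margProb_jointLaw_s hPYX hPUgS hPXgUS hPZgUY] at h
    rw [h]
    rfl
  · intro δ hδ
    obtain ⟨n₀, h⟩ := H δ hδ
    refine ⟨n₀, fun n hn => ?_⟩
    obtain ⟨N, T, hT, hω⟩ := h n hn
    exact ⟨N, hT.trans_le (prob_mono (IsPMF.prod_pi fun _ => hQ).1 hω)⟩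

lemma achievable_of_mutInfo_eq_zero (hPS : IsPMF PS) (hPYX : ∀ x, IsPMF (PYX x))
    (hPUgS : ∀ s, IsPMF (PUgS s)) (hPXgUS : ∀ u s, IsPMF (PXgUS u s))
    (hPZgUY : ∀ u y, IsPMF (PZgUY u y))
    (hI : mutInfo (jointLaw PS PYX PUgS PXgUS PZgUY) (fun ω => ω.2.2.2.2) (fun ω => ω.1) = 0) :
    Achievable PS PYX EncoderClass.noncausal
      fun a => ∑ u, jointLaw PS PYX PUgS PXgUS PZgUY (a.1, a.2.1, a.2.2.1, a.2.2.2, u) := by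
  have hQ := isPMF_jointLaw hPS hPYX hPUgS hPXgUS hPZgUY
  refine achievable_of_likelihoodRatio_factors hPS hPYX hPUgS hPXgUS hPZgUY fun δ hδ => ?_
  obtain ⟨n₀, h⟩ := exists_prob_iid_gt hQ (fun e : Empty => e.elim) one_pos hδ
  refine ⟨n₀, fun n hn => ⟨0, {ω | ∀ i, 0 < jointLaw PS PYX PUgS PXgUS PZgUY (ω i)},
    h n hn _ fun ω hω _ => hω, fun ω hω => ?_⟩⟩
  have hL := Finset.prod_eq_one fun i (_ : i ∈ Finset.univ) =>
    likelihoodRatio_eq_one_of_mutInfo_eq_zero hQ hI (hω i)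
  have hK := Finset.prod_pos fun i (_ : i ∈ Finset.univ) =>
    likelihoodRatio_pos hQ (fun ω => ω.2.2.2.2) (fun ω => ω.2.2.1) (hω i)
  rw [hL, Nat.cast_zero, add_zero, add_zero, zero_add, div_self hK.ne']
  linarith

lemma one_sub_two_mul_le_success_factor {L K N e : ℝ} (hL : 0 < L) (hK : 0 < K) (hN : 0 ≤ N)
    (he : 0 ≤ e) (hLe : L ≤ e * (N + 1)) (hNe : N ≤ e * K) :
    1 - 2 * e ≤ (N + 1) / (L + N) * (K / (K + N)) := by
  have h1 : 1 / (1 + e) ≤ (N + 1) / (L + N) := by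
    rw [div_le_div_iff₀ (by positivity) (by positivity)]
    linarith
  have h2 : 1 / (1 + e) ≤ K / (K + N) := by
    rw [div_le_div_iff₀ (by positivity) (by positivity)]
    linarith
  refine le_trans ?_ (mul_le_mul h1 h2 (by positivity) (by positivity))
  rw [div_mul_div_comm, le_div_iff₀ (by positivity)]
  nlinarith [mul_nonneg he he, mul_nonneg (mul_nonneg he he) he]

lemma achievable_of_mutInfo_lt (hPS : IsPMF PS) (hPYX : ∀ x, IsPMF (PYX x))
    (hPUgS : ∀ s, IsPMF (PUgS s)) (hPXgUS : ∀ u s, IsPMF (PXgUS u s))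
    (hPZgUY : ∀ u y, IsPMF (PZgUY u y))
    (hI : mutInfo (jointLaw PS PYX PUgS PXgUS PZgUY) (fun ω => ω.2.2.2.2) (fun ω => ω.1) <
      mutInfo (jointLaw PS PYX PUgS PXgUS PZgUY) (fun ω => ω.2.2.2.2) (fun ω => ω.2.2.1)) :
    Achievable PS PYX EncoderClass.noncausal
      fun a => ∑ u, jointLaw PS PYX PUgS PXgUS PZgUY (a.1, a.2.1, a.2.2.1, a.2.2.2, u) := by
  have hQ := isPMF_jointLaw hPS hPYX hPUgS hPXgUS hPZgUY
  refine achievable_of_likelihoodRatio_factors hPS hPYX hPUgS hPXgUS hPZgUY fun δ hδ => ?_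
  rw [mutInfo_eq_sum, mutInfo_eq_sum, div_lt_div_iff_of_pos_right (Real.log_pos one_lt_two)] at hI
  set Q := jointLaw PS PYX PUgS PXgUS PZgUY with hQdef
  set l : S × X × Y × Z × U → ℝ := fun ω =>
    likelihoodRatio Q (fun ω => ω.2.2.2.2) (fun ω => ω.1) ω.2.2.2.2 ω.1 with hl
  set k : S × X × Y × Z × U → ℝ := fun ω =>
    likelihoodRatio Q (fun ω => ω.2.2.2.2) (fun ω => ω.2.2.1) ω.2.2.2.2 ω.2.2.1 with hk
  set I₁ := ∑ ω, Q ω * Real.log (l ω) with hI₁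
  set I₂ := ∑ ω, Q ω * Real.log (k ω) with hI₂
  replace hI : I₁ < I₂ := hI
  set η := (I₂ - I₁) / 4 with hη
  have hη0 : 0 < η := by rw [hη]; linarith
  obtain ⟨n₁, h₁⟩ := exists_prob_iid_gt hQ
    (fun b : Bool => if b then fun ω => Real.log (l ω) else fun ω => Real.log (k ω)) hη0 hδ
  obtain ⟨n₂, h₂⟩ : ∃ n₂ : ℕ, ∀ n ≥ n₂, Real.exp (-(n * η)) < δ / 2 := by
    have ht : Filter.Tendsto (fun n : ℕ => Real.exp (-((n : ℝ) * η))) Filter.atTop (nhds 0) :=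
      Real.tendsto_exp_neg_atTop_nhds_zero.comp
        (tendsto_natCast_atTop_atTop.atTop_mul_const hη0)
    exact Filter.eventually_atTop.1 (ht.eventually_lt_const (by positivity))
  refine ⟨max n₁ n₂, fun n hn => ?_⟩
  set N := ⌊Real.exp (n * ((I₁ + I₂) / 2))⌋₊ with hN
  refine ⟨N, {ω | 1 - δ ≤ (N + 1) / (∏ i, l (ω i) + N) *
    ((∏ i, k (ω i)) / (∏ i, k (ω i) + N))}, h₁ n (le_of_max_le_left hn) _ ?_, fun ω hω => hω⟩
  intro ω hω htyp
  have hlpos : ∀ i, 0 < l (ω i) := fun i => likelihoodRatio_pos hQ _ _ (hω i)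
  have hkpos : ∀ i, 0 < k (ω i) := fun i => likelihoodRatio_pos hQ _ _ (hω i)
  have hlexp : ∏ i, l (ω i) = Real.exp (∑ i, Real.log (l (ω i))) := by
    rw [Real.exp_sum]
    exact Finset.prod_congr rfl fun i _ => (Real.exp_log (hlpos i)).symm
  have hkexp : ∏ i, k (ω i) = Real.exp (∑ i, Real.log (k (ω i))) := by
    rw [Real.exp_sum]
    exact Finset.prod_congr rfl fun i _ => (Real.exp_log (hkpos i)).symm
  have ht₁ : |∑ i, Real.log (l (ω i)) - n * I₁| ≤ n * η := by simpa using htyp true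
  have ht₂ : |∑ i, Real.log (k (ω i)) - n * I₂| ≤ n * η := by simpa using htyp false
  have hNle : (N : ℝ) ≤ Real.exp (n * ((I₁ + I₂) / 2)) := Nat.floor_le (Real.exp_pos _).le
  have hNlt : Real.exp (n * ((I₁ + I₂) / 2)) < N + 1 := Nat.lt_floor_add_one _
  have hmain := one_sub_two_mul_le_success_factor
    (Finset.prod_pos fun i (_ : i ∈ Finset.univ) => hlpos i)
    (Finset.prod_pos fun i (_ : i ∈ Finset.univ) => hkpos i) N.cast_nonneg
    (Real.exp_pos (-(n * η))).le
    (by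
      refine le_trans ?_ (mul_le_mul_of_nonneg_left hNlt.le (Real.exp_pos _).le)
      rw [hlexp, ← Real.exp_add]
      refine Real.exp_le_exp.2 ?_
      have e : n * ((I₁ + I₂) / 2) = n * I₁ + 2 * (n * η) := by rw [hη]; ring
      linarith [(abs_le.1 ht₁).2])
    (by
      refine hNle.trans ?_
      rw [hkexp, ← Real.exp_add]
      refine Real.exp_le_exp.2 ?_
      have e : n * ((I₁ + I₂) / 2) = n * I₂ - 2 * (n * η) := by rw [hη]; ring
      linarith [(abs_le.1 ht₂).1])
  refine le_trans ?_ hmain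
  linarith [h₂ n (le_of_max_le_right hn)]

end CoordinationKernels

section TimeSharing

variable {S X Y Z U : Type*} [Fintype S] [Fintype X] [Fintype Y] [Fintype Z] [Fintype U]
  {PS : S → ℝ} {PYX : X → Y → ℝ} {PUgS : S → U → ℝ} {PXgUS : U → S → X → ℝ}
  {PZgUY : U → Y → Z → ℝ}

lemma achievable_of_forall_tvDist_le {c : EncoderClass} (hPS : IsPMF PS)
    (hPYX : ∀ x, IsPMF (PYX x)) {P : S × X × Y × Z → ℝ}
    (h : ∀ η : ℝ, 0 < η → ∃ P', Achievable PS PYX c P' ∧ tvDist P' P ≤ η) :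
    Achievable PS PYX c P := by
  intro ε hε
  obtain ⟨P', hP', hd⟩ := h (ε / 2) (half_pos hε)
  obtain ⟨n, hn, f, g, hc, hprob⟩ := hP' (ε / 2) (half_pos hε)
  refine ⟨n, hn, f, g, hc, lt_of_le_of_lt (prob_mono (isPMF_inducedP hPS hPYX f).1 ?_)
    (hprob.trans (half_lt_self hε))⟩
  intro sy hsy
  have htri : ∀ R : S × X × Y × Z → ℝ, tvDist R P ≤ tvDist R P' + tvDist P' P := fun R => by
    rw [tvDist, tvDist, tvDist, ← add_div, ← Finset.sum_add_distrib]
    gcongr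
    exact abs_sub_le _ _ _
  have h1 : ε < tvDist (empDist fun i => (sy.1 i, f i sy.1, sy.2 i, g i sy.2)) P := hsy
  change ε / 2 < tvDist (empDist fun i => (sy.1 i, f i sy.1, sy.2 i, g i sy.2)) P'
  linarith [htri (empDist fun i => (sy.1 i, f i sy.1, sy.2 i, g i sy.2))]

/-- The conditional law of `X` given `U`. -/
lemma exists_input_kernel (hPS : IsPMF PS) (hPUgS : ∀ s, IsPMF (PUgS s))
    (hPXgUS : ∀ u s, IsPMF (PXgUS u s)) :
    ∃ R : U → X → ℝ, (∀ u, IsPMF (R u)) ∧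
      ∀ u x, (∑ s, PS s * PUgS s u) * R u x = ∑ s, PS s * PUgS s u * PXgUS u s x := by
  have hnn : ∀ u s, 0 ≤ PS s * PUgS s u := fun u s => mul_nonneg (hPS.1 s) ((hPUgS s).1 u)
  have h : ∀ u, ∃ r : X → ℝ, IsPMF r ∧
      ∀ x, (∑ s, PS s * PUgS s u) * r x = ∑ s, PS s * PUgS s u * PXgUS u s x := by
    intro u
    rcases eq_or_ne (∑ s, PS s * PUgS s u) 0 with h0 | h0
    · obtain ⟨s₀⟩ := hPS.nonempty
      refine ⟨PXgUS u s₀, hPXgUS u s₀, fun x => ?_⟩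
      rw [Finset.sum_eq_zero_iff_of_nonneg fun s _ => hnn u s] at h0
      rw [Finset.sum_eq_zero h0, zero_mul,
        Finset.sum_eq_zero fun s hs => by rw [h0 s hs, zero_mul]]
    · refine ⟨fun x => (∑ s, PS s * PUgS s u * PXgUS u s x) / ∑ s, PS s * PUgS s u,
        ⟨fun x => div_nonneg (Finset.sum_nonneg fun s _ => mul_nonneg (hnn u s)
          ((hPXgUS u s).1 x)) (Finset.sum_nonneg fun s _ => hnn u s), ?_⟩,
        fun x => mul_div_cancel₀ _ h0⟩
      rw [← Finset.sum_div, Finset.sum_comm]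
      simp_rw [← Finset.mul_sum, (hPXgUS u _).2, mul_one]
      exact div_self h0
  choose R hR hR' using h
  exact ⟨R, hR, hR'⟩

/-- Sharing a fraction `t` of the time with an auxiliary variable independent of the source. -/
def sharedAux (PS : S → ℝ) (PUgS : S → U → ℝ) (t : ℝ) (s : S) : U ⊕ U → ℝ :=
  Sum.elim (fun u => (1 - t) * PUgS s u) fun u => t * ∑ s', PS s' * PUgS s' u

lemma isPMF_sum_source (hPS : IsPMF PS) (hPUgS : ∀ s, IsPMF (PUgS s)) :
    IsPMF fun u => ∑ s, PS s * PUgS s u := by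
  refine ⟨fun u => Finset.sum_nonneg fun s _ => mul_nonneg (hPS.1 s) ((hPUgS s).1 u), ?_⟩
  rw [Finset.sum_comm]
  simp_rw [← Finset.mul_sum, (hPUgS _).2, mul_one, hPS.2]

lemma isPMF_sharedAux (hPS : IsPMF PS) (hPUgS : ∀ s, IsPMF (PUgS s)) {t : ℝ} (ht0 : 0 ≤ t)
    (ht1 : t ≤ 1) (s : S) : IsPMF (sharedAux PS PUgS t s) := by
  have h := isPMF_sum_source hPS hPUgS
  constructor
  · rintro (u | u)
    · exact mul_nonneg (by linarith) ((hPUgS s).1 u)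
    · exact mul_nonneg ht0 (h.1 u)
  · rw [Fintype.sum_sum_type]
    simp only [sharedAux, Sum.elim_inl, Sum.elim_inr, ← Finset.mul_sum, (hPUgS s).2, h.2]
    ring

lemma mutInfo_sharedAux_source (hPS : IsPMF PS) (hPYX : ∀ x, IsPMF (PYX x))
    (hPUgS : ∀ s, IsPMF (PUgS s)) (hPXgUS : ∀ u s, IsPMF (PXgUS u s))
    (hPZgUY : ∀ u y, IsPMF (PZgUY u y)) {R : U → X → ℝ} (hR : ∀ u, IsPMF (R u)) {t : ℝ}
    (ht0 : 0 ≤ t) (ht1 : t < 1) :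
    mutInfo (jointLaw PS PYX (sharedAux PS PUgS t) (Sum.elim PXgUS fun u _ => R u)
      (Sum.elim PZgUY PZgUY)) (fun ω => ω.2.2.2.2) (fun ω => ω.1) =
    (1 - t) * mutInfo (jointLaw PS PYX PUgS PXgUS PZgUY) (fun ω => ω.2.2.2.2)
      (fun ω => ω.1) := by
  have hX' : ∀ u s, IsPMF ((Sum.elim PXgUS fun u _ => R u : U ⊕ U → S → X → ℝ) u s) := by
    rintro (u | u) s
    exacts [hPXgUS u s, hR u]
  have hZ' : ∀ u y, IsPMF ((Sum.elim PZgUY PZgUY : U ⊕ U → Y → Z → ℝ) u y) := by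
    rintro (u | u) y <;> exact hPZgUY u y
  have ht : (1 - t) ≠ 0 := by linarith
  simp only [mutInfo, margProb_jointLaw_us hPYX hX' hZ', margProb_jointLaw_u hPYX hX' hZ',
    margProb_jointLaw_s hPYX (isPMF_sharedAux hPS hPUgS ht0 ht1.le) hX' hZ',
    margProb_jointLaw_us hPYX hPXgUS hPZgUY, margProb_jointLaw_u hPYX hPXgUS hPZgUY,
    margProb_jointLaw_s hPYX hPUgS hPXgUS hPZgUY, Fintype.sum_sum_type, sharedAux, Sum.elim_inl,
    Sum.elim_inr, ← Finset.sum_mul, hPS.2, one_mul, Finset.mul_sum (a := 1 - t)]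
  have h0 : ∀ x : ℝ, Real.logb 2 (x / x) = 0 := fun x => by
    rcases eq_or_ne x 0 with h | h <;> simp [h]
  rw [Finset.sum_eq_zero (f := fun u => ∑ s, PS s * (t * ∑ s', PS s' * PUgS s' u) * _)
    fun u _ => Finset.sum_eq_zero fun s _ => by rw [mul_comm (PS s), h0, mul_zero], add_zero]
  refine Finset.sum_congr rfl fun u _ => Finset.sum_congr rfl fun s _ => ?_
  have e : ∑ s', PS s' * ((1 - t) * PUgS s' u) = (1 - t) * ∑ s', PS s' * PUgS s' u := by
    rw [Finset.mul_sum]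
    exact Finset.sum_congr rfl fun _ _ => by ring
  rw [e, mul_left_comm (PS s), mul_assoc (1 - t), mul_assoc (1 - t), mul_div_mul_left _ _ ht]

lemma mutInfo_sharedAux_output (hPS : IsPMF PS) (hPYX : ∀ x, IsPMF (PYX x))
    (hPXgUS : ∀ u s, IsPMF (PXgUS u s)) (hPZgUY : ∀ u y, IsPMF (PZgUY u y)) {R : U → X → ℝ}
    (hR : ∀ u, IsPMF (R u))
    (hRX : ∀ u x, (∑ s, PS s * PUgS s u) * R u x = ∑ s, PS s * PUgS s u * PXgUS u s x) {t : ℝ}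
    (ht0 : 0 < t) (ht1 : t < 1) :
    mutInfo (jointLaw PS PYX (sharedAux PS PUgS t) (Sum.elim PXgUS fun u _ => R u)
      (Sum.elim PZgUY PZgUY)) (fun ω => ω.2.2.2.2) (fun ω => ω.2.2.1) =
    mutInfo (jointLaw PS PYX PUgS PXgUS PZgUY) (fun ω => ω.2.2.2.2) (fun ω => ω.2.2.1) := by
  have hX' : ∀ u s, IsPMF ((Sum.elim PXgUS fun u _ => R u : U ⊕ U → S → X → ℝ) u s) := by
    rintro (u | u) s
    exacts [hPXgUS u s, hR u]
  have hZ' : ∀ u y, IsPMF ((Sum.elim PZgUY PZgUY : U ⊕ U → Y → Z → ℝ) u y) := by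
    rintro (u | u) y <;> exact hPZgUY u y
  have ht : (1 - t) ≠ 0 := by linarith
  have hl : ∀ u, ∑ s, PS s * ((1 - t) * PUgS s u) = (1 - t) * ∑ s, PS s * PUgS s u := by
    intro u
    rw [Finset.mul_sum]
    exact Finset.sum_congr rfl fun _ _ => by ring
  have hly : ∀ u y, ∑ s, ∑ x, PS s * ((1 - t) * PUgS s u) * PXgUS u s x * PYX x y =
      (1 - t) * ∑ s, ∑ x, PS s * PUgS s u * PXgUS u s x * PYX x y := by
    intro u y
    simp_rw [Finset.mul_sum]
    exact Finset.sum_congr rfl fun _ _ => Finset.sum_congr rfl fun _ _ => by ring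
  have hry : ∀ u y, ∑ s, ∑ x, PS s * (t * ∑ s', PS s' * PUgS s' u) * R u x * PYX x y =
      t * ∑ s, ∑ x, PS s * PUgS s u * PXgUS u s x * PYX x y := by
    intro u y
    have e : ∀ s, ∑ x, PS s * (t * ∑ s', PS s' * PUgS s' u) * R u x * PYX x y =
        PS s * (t * ∑ x, (∑ s', PS s' * PUgS s' u * PXgUS u s' x) * PYX x y) := by
      intro s
      simp_rw [← hRX]
      generalize ∑ s', PS s' * PUgS s' u = c
      simp_rw [Finset.mul_sum]
      exact Finset.sum_congr rfl fun _ _ => by ring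
    simp_rw [e, ← Finset.sum_mul, hPS.2, one_mul]
    rw [Finset.sum_comm]
    simp_rw [Finset.sum_mul]
  simp only [mutInfo, margProb_jointLaw_uy hZ', margProb_jointLaw_u hPYX hX' hZ',
    margProb_jointLaw_y hZ', margProb_jointLaw_uy hPZgUY, margProb_jointLaw_u hPYX hPXgUS hPZgUY,
    margProb_jointLaw_y hPZgUY, Fintype.sum_sum_type, sharedAux, Sum.elim_inl, Sum.elim_inr,
    hl, hly, hry, ← Finset.sum_mul, hPS.2, one_mul, ← Finset.mul_sum]
  rw [← Finset.sum_add_distrib]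
  refine Finset.sum_congr rfl fun u _ => ?_
  rw [← Finset.sum_add_distrib]
  refine Finset.sum_congr rfl fun y _ => ?_
  rw [← add_mul, sub_add_cancel, one_mul, mul_assoc (1 - t) (∑ s, PS s * PUgS s u),
    mul_assoc t (∑ s, PS s * PUgS s u), mul_div_mul_left _ _ ht, mul_div_mul_left _ _ ht0.ne']
  ring

lemma tvDist_sharedAux_le (hPS : IsPMF PS) (hPYX : ∀ x, IsPMF (PYX x))
    (hPUgS : ∀ s, IsPMF (PUgS s)) (hPXgUS : ∀ u s, IsPMF (PXgUS u s))
    (hPZgUY : ∀ u y, IsPMF (PZgUY u y)) {R : U → X → ℝ} (hR : ∀ u, IsPMF (R u)) {t : ℝ}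
    (ht0 : 0 ≤ t) :
    tvDist (fun a : S × X × Y × Z => ∑ u, jointLaw PS PYX (sharedAux PS PUgS t)
        (Sum.elim PXgUS fun u _ => R u) (Sum.elim PZgUY PZgUY) (a.1, a.2.1, a.2.2.1, a.2.2.2, u))
      (fun a => ∑ u, jointLaw PS PYX PUgS PXgUS PZgUY (a.1, a.2.1, a.2.2.1, a.2.2.2, u)) ≤ t := by
  have hQ := isPMF_jointLaw hPS hPYX hPUgS hPXgUS hPZgUY
  have hQ₂ := isPMF_jointLaw hPS hPYX (fun _ => isPMF_sum_source hPS hPUgS)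
    (fun u (_ : S) => hR u) hPZgUY
  set Q := jointLaw PS PYX PUgS PXgUS PZgUY with hQdef
  set Q₂ := jointLaw PS PYX (fun _ u => ∑ s, PS s * PUgS s u) (fun u _ => R u) PZgUY with hQ₂def
  have hmix : ∀ a : S × X × Y × Z, ∑ u, jointLaw PS PYX (sharedAux PS PUgS t)
      (Sum.elim PXgUS fun u _ => R u) (Sum.elim PZgUY PZgUY) (a.1, a.2.1, a.2.2.1, a.2.2.2, u) =
      (1 - t) * ∑ u, Q (a.1, a.2.1, a.2.2.1, a.2.2.2, u) +
        t * ∑ u, Q₂ (a.1, a.2.1, a.2.2.1, a.2.2.2, u) := by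
    intro a
    rw [Fintype.sum_sum_type, Finset.mul_sum (a := 1 - t), Finset.mul_sum (a := t)]
    congr 1 <;> refine Finset.sum_congr rfl fun u _ => ?_ <;>
      simp only [hQdef, hQ₂def, jointLaw, sharedAux, Sum.elim_inl, Sum.elim_inr] <;> ring
  have hone : ∀ F : S × X × Y × Z × U → ℝ, IsPMF F →
      ∑ a : S × X × Y × Z, ∑ u, F (a.1, a.2.1, a.2.2.1, a.2.2.2, u) = 1 := by
    intro F hF
    rw [← hF.2]
    simp_rw [Fintype.sum_prod_type]
  have hpt : ∀ a : S × X × Y × Z, |∑ u, jointLaw PS PYX (sharedAux PS PUgS t)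
      (Sum.elim PXgUS fun u _ => R u) (Sum.elim PZgUY PZgUY) (a.1, a.2.1, a.2.2.1, a.2.2.2, u) -
      ∑ u, Q (a.1, a.2.1, a.2.2.1, a.2.2.2, u)| ≤
      t * (∑ u, Q (a.1, a.2.1, a.2.2.1, a.2.2.2, u) +
        ∑ u, Q₂ (a.1, a.2.1, a.2.2.1, a.2.2.2, u)) := by
    intro a
    have h1 := Finset.sum_nonneg fun u (_ : u ∈ Finset.univ) =>
      hQ.1 (a.1, a.2.1, a.2.2.1, a.2.2.2, u)
    have h2 := Finset.sum_nonneg fun u (_ : u ∈ Finset.univ) =>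
      hQ₂.1 (a.1, a.2.1, a.2.2.1, a.2.2.2, u)
    rw [hmix, abs_le]
    constructor <;> nlinarith [mul_nonneg ht0 h1, mul_nonneg ht0 h2]
  rw [tvDist, div_le_iff₀ two_pos]
  refine (Finset.sum_le_sum fun a _ => hpt a).trans (le_of_eq ?_)
  rw [← Finset.mul_sum, Finset.sum_add_distrib, hone Q hQ, hone Q₂ hQ₂]
  norm_num

end TimeSharing

/-- **Theorem 1 (Noncausal encoder, inner bound).**
If there are a finite set `U` and a joint pmf `Q` on `S × X × Y × Ŝ × U` factoring as
`P_S · P_{U|S} · P_{X|US} · P_{Y|X} · P_{Ŝ|UY}` with `I(U;S) ≤ I(U;Y)`, then the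
`(S,X,Y,Ŝ)`-marginal `P` of `Q` is achievable with a noncausal encoder. -/
theorem noncausal_inner_bound
    {S X Y Z U : Type} [Fintype S] [Fintype X] [Fintype Y] [Fintype Z] [Fintype U]
    (PS : S → ℝ) (PYX : X → Y → ℝ)
    (hPS : IsPMF PS) (hPYX : ∀ x, IsPMF (PYX x))
    (PUgS : S → U → ℝ) (PXgUS : U → S → X → ℝ) (PZgUY : U → Y → Z → ℝ)
    (hPUgS : ∀ s, IsPMF (PUgS s)) (hPXgUS : ∀ u s, IsPMF (PXgUS u s))
    (hPZgUY : ∀ u y, IsPMF (PZgUY u y))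
    (Q : S × X × Y × Z × U → ℝ)
    (hQ : ∀ s x y z u,
      Q (s, x, y, z, u) = PS s * PUgS s u * PXgUS u s x * PYX x y * PZgUY u y z)
    (hMI : mutInfo Q (fun ω => ω.2.2.2.2) (fun ω => ω.1)
         ≤ mutInfo Q (fun ω => ω.2.2.2.2) (fun ω => ω.2.2.1))
    (P : S × X × Y × Z → ℝ)
    (hP : ∀ s x y z, P (s, x, y, z) = ∑ u, Q (s, x, y, z, u)) :
    Achievable PS PYX EncoderClass.noncausal P := by
  obtain rfl : Q = jointLaw PS PYX PUgS PXgUS PZgUY :=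
    funext fun ⟨s, x, y, z, u⟩ => hQ s x y z u
  obtain rfl : P = fun a => ∑ u, jointLaw PS PYX PUgS PXgUS PZgUY
      (a.1, a.2.1, a.2.2.1, a.2.2.2, u) := funext fun ⟨s, x, y, z⟩ => hP s x y z
  by_cases h0 : mutInfo (jointLaw PS PYX PUgS PXgUS PZgUY) (fun ω => ω.2.2.2.2)
      (fun ω => ω.1) = 0
  · exact achievable_of_mutInfo_eq_zero hPS hPYX hPUgS hPXgUS hPZgUY h0
  have hpos := (mutInfo_nonneg (isPMF_jointLaw hPS hPYX hPUgS hPXgUS hPZgUY)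
    (fun ω => ω.2.2.2.2) (fun ω => ω.1)).lt_of_ne' h0
  obtain ⟨R, hR, hRX⟩ := exists_input_kernel hPS hPUgS hPXgUS
  refine achievable_of_forall_tvDist_le hPS hPYX fun η hη => ?_
  obtain ⟨t, ht0, ht⟩ := exists_between (lt_min hη one_pos)
  have ht1 : t < 1 := ht.trans_le (min_le_right _ _)
  refine ⟨_, achievable_of_mutInfo_lt hPS hPYX (isPMF_sharedAux hPS hPUgS ht0.le ht1.le)
    (PXgUS := Sum.elim PXgUS fun u _ => R u) (PZgUY := Sum.elim PZgUY PZgUY) ?_ ?_ ?_,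
    (tvDist_sharedAux_le hPS hPYX hPUgS hPXgUS hPZgUY hR ht0.le).trans
      (ht.le.trans (min_le_left _ _))⟩
  · rintro (u | u) s
    exacts [hPXgUS u s, hR u]
  · rintro (u | u) y <;> exact hPZgUY u y
  · rw [mutInfo_sharedAux_source hPS hPYX hPUgS hPXgUS hPZgUY hR ht0.le ht1,
      mutInfo_sharedAux_output hPS hPYX hPXgUS hPZgUY hR hRX ht0 ht1]
    nlinarith

end
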